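/- Let n ≥ 2, ℓ ≥ 1 and 2 ≤ d₁ < d₂ < ⋯ < d_ℓ ≤ n−1. Then (ω((n, {d₁,…,d_ℓ})) : ℤ) = ω((n−1, {d₁−1,…,d_ℓ−1})) + Σ over all nonempty subsets S = {p₁ < ⋯ < p_j} of {1,…,ℓ} of (−1)^{j+ℓ} · C(n−1, d_{p₁}) · ∏_{i=2}^{j} C(n − d_{p_{i−1}}, d_{p_i} − d_{p_{i−1}}). -/

import Mathlib

inductive PTree : Type
  | leaf : PTree
  | node : PTree → PTree → PTree
  deriving DecidableEq

namespace PTree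

/-- The grade of a planar binary rooted tree: its number of binary (internal) nodes. -/
def grade : PTree → ℕ
  | leaf => 0
  | node t1 t2 => grade t1 + grade t2 + 1

/-- The weight character of a planar binary rooted tree. -/
def alpha : PTree → ℕ
  | leaf => 1
  | node t1 t2 => Nat.choose (grade t1 + grade t2) (grade t1) * alpha t1 * alpha t2

end PTree

/-- The (finite) set of all planar binary rooted trees of a given grade. -/
def treesOfGrade : ℕ → Finset PTree
  | 0 => {PTree.leaf}
  | n + 1 =>
    (Finset.range (n + 1)).attach.biUnion fun j =>
      (treesOfGrade j.1 ×ˢ treesOfGrade (n - j.1)).image fun p => PTree.node p.1 p.2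
termination_by n => n
decreasing_by
  · exact Finset.mem_range.mp j.2
  · exact Nat.lt_succ_of_le (Nat.sub_le n j.1)

/-- A descent: a grade `n` together with a subset of `{1, …, n-1}`. -/
structure Descent : Type where
  grade : ℕ
  dset : Finset ℕ
  valid : dset ⊆ Finset.Icc 1 (grade - 1)

instance : DecidableEq Descent := fun a b =>
  decidable_of_iff (a.grade = b.grade ∧ a.dset = b.dset) (by
    constructor
    · rintro ⟨h1, h2⟩
      obtain ⟨g1, s1, v1⟩ := a
      obtain ⟨g2, s2, v2⟩ := b
      dsimp at h1 h2
      subst h1; subst h2; rfl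
    · rintro rfl; exact ⟨rfl, rfl⟩)

/-- The empty descent `∅₀` of grade `0`. -/
def emptyDescent : Descent := ⟨0, ∅, by simp⟩

/-- The grafting product of two descents. -/
def dstar (a b : Descent) : Descent where
  grade := a.grade + b.grade + 1
  dset := a.dset ∪ b.dset.image (fun e => e + a.grade + 1) ∪
    (if 1 ≤ a.grade then {a.grade} else ∅)
  valid := by
    intro x hx
    simp only [Finset.mem_union, Finset.mem_image] at hx
    simp only [Finset.mem_Icc]
    rcases hx with (hx | hx) | hx
    · have h := Finset.mem_Icc.mp (a.valid hx); omega
    · obtain ⟨e, he, rfl⟩ := hx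
      have h := Finset.mem_Icc.mp (b.valid he); omega
    · split_ifs at hx with h
      · rw [Finset.mem_singleton] at hx; omega
      · simp at hx

/-- The descent of a planar binary rooted tree. -/
def desc : PTree → Descent
  | .leaf => emptyDescent
  | .node t1 t2 => dstar (desc t1) (desc t2)

/-- The weight of a descent: the sum of the weight characters `α(τ)` over all (finitely many)
planar binary rooted trees `τ` with `desc τ = d`. -/
noncomputable def omegaD (d : Descent) : ℕ :=
  ∑ᶠ (τ : PTree) (_ : desc τ = d), PTree.alpha τ

/-- The (finite) set of all descents of a given grade. -/
def descentsOfGrade (n : ℕ) : Finset Descent :=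
  (Finset.Icc 1 (n - 1)).powerset.attach.image fun D =>
    ⟨n, D.1, Finset.mem_powerset.mp D.2⟩

/-- `chainProdAux n prev [b₁, …, b_j] = C(n − prev, b₁ − prev) · C(n − b₁, b₂ − b₁) ⋯`. -/
def chainProdAux (n : ℕ) : ℕ → List ℕ → ℕ
  | _, [] => 1
  | prev, b :: t => Nat.choose (n - prev) (b - prev) * chainProdAux n b t

/-- `chainProd' n [a₁, …, a_j] = C(n−1, a₁) · C(n − a₁, a₂ − a₁) ⋯`: first factor from `n−1`,
subsequent factors from `n`. -/
def chainProd' (n : ℕ) : List ℕ → ℕ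
  | [] => 1
  | a :: t => Nat.choose (n - 1) a * chainProdAux n a t

open Finset in
theorem sum_trees_succ {M : Type*} [AddCommMonoid M] (n : ℕ) (f : PTree → M) :
    ∑ t ∈ treesOfGrade (n + 1), f t =
      ∑ k ∈ range (n + 1), ∑ t1 ∈ treesOfGrade k, ∑ t2 ∈ treesOfGrade (n - k),
        f (PTree.node t1 t2) := by
  have hg : ∀ n t, t ∈ treesOfGrade n → t.grade = n := by
    intro n
    induction n using Nat.strong_induction_on with
    | _ n ih =>
      intro t ht
      cases n with
      | zero =>
        rw [treesOfGrade] at ht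
        simp only [mem_singleton] at ht
        subst ht; rfl
      | succ n =>
        rw [treesOfGrade] at ht
        simp only [mem_biUnion, mem_attach, true_and, mem_image, mem_product, Prod.exists,
          Subtype.exists, mem_range] at ht
        obtain ⟨k, hk, a, b, ⟨ha, hb⟩, rfl⟩ := ht
        have h1 := ih k hk a ha
        have h2 := ih (n - k) (by omega) b hb
        simp only [PTree.grade, h1, h2]
        omega
  rw [treesOfGrade, sum_biUnion]
  · rw [← sum_attach (range (n + 1))]
    refine sum_congr rfl fun k _ => ?_
    rw [sum_image, sum_product]
    rintro ⟨a, b⟩ _ ⟨c, e⟩ _ h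
    simpa using h
  · intro i _ j _ hij
    rw [Function.onFun, disjoint_left]
    intro t hi hj
    simp only [mem_image, mem_product, Prod.exists] at hi hj
    obtain ⟨a, b, ⟨ha, hb⟩, rfl⟩ := hi
    obtain ⟨c, e, ⟨hc, he⟩, h⟩ := hj
    simp only [PTree.node.injEq] at h
    apply hij
    apply Subtype.ext
    rw [← hg _ _ ha, ← hg _ _ hc, h.1]

theorem mem_trees (t : PTree) (n : ℕ) : t ∈ treesOfGrade n ↔ t.grade = n := by
  induction t generalizing n with
  | leaf =>
    cases n with
    | zero => rw [treesOfGrade]; simp [PTree.grade]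
    | succ n => rw [treesOfGrade]; simp [PTree.grade]
  | node a b iha ihb =>
    cases n with
    | zero => rw [treesOfGrade]; simp [PTree.grade]
    | succ n =>
      rw [treesOfGrade]
      simp only [Finset.mem_biUnion, Finset.mem_attach, true_and, Finset.mem_image,
        Finset.mem_product, Prod.exists, Subtype.exists, Finset.mem_range, iha, ihb, PTree.grade,
        PTree.node.injEq]
      constructor
      · rintro ⟨k, hk, c, e, ⟨h1, h2⟩, rfl, rfl⟩
        rw [iha] at h1
        rw [ihb] at h2
        omega
      · intro h
        refine ⟨a.grade, by omega, a, b, ⟨?_, ?_⟩, rfl, rfl⟩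
        · rw [iha]
        · rw [ihb]; omega

theorem desc_grade (t : PTree) : (desc t).grade = t.grade := by
  induction t with
  | leaf => rfl
  | node a b iha ihb => simp [desc, dstar, PTree.grade, iha, ihb]

open Classical in
/-- Total weight of trees of grade `n` whose descents satisfy `P`. -/
noncomputable def AA (n : ℕ) (P : ℕ → Prop) : ℕ :=
  ∑ t ∈ treesOfGrade n, if ∀ x ∈ (desc t).dset, P x then t.alpha else 0

theorem AA_zero (P : ℕ → Prop) : AA 0 P = 1 := by
  rw [AA, treesOfGrade]
  simp [desc, emptyDescent, PTree.alpha]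

theorem AA_congr (n : ℕ) (P Q : ℕ → Prop) (h : ∀ x, 1 ≤ x → x ≤ n - 1 → (P x ↔ Q x)) :
    AA n P = AA n Q := by
  classical
  refine Finset.sum_congr rfl fun t ht => ?_
  rw [mem_trees] at ht
  congr 1
  apply propext
  refine forall₂_congr fun x hx => ?_
  have := Finset.mem_Icc.mp ((desc t).valid hx)
  rw [desc_grade, ht] at this
  exact h x this.1 this.2

open Classical in
theorem AA_succ (n : ℕ) (P : ℕ → Prop) :
    AA (n + 1) P = ∑ k ∈ Finset.range (n + 1), if k = 0 ∨ P k then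
      n.choose k * AA k P * AA (n - k) (fun x => P (x + (k + 1))) else 0 := by
  rw [AA, sum_trees_succ]
  refine Finset.sum_congr rfl fun k hk => ?_
  rw [Finset.mem_range] at hk
  have key : ∀ a ∈ treesOfGrade k, ∀ b : PTree,
      (∀ x ∈ (desc (PTree.node a b)).dset, P x) ↔
        (k = 0 ∨ P k) ∧ (∀ x ∈ (desc a).dset, P x) ∧
          ∀ x ∈ (desc b).dset, P (x + (k + 1)) := by
    intro a ha b
    rw [mem_trees] at ha
    have hga : (desc a).grade = k := by rw [desc_grade, ha]
    simp only [desc, dstar, hga, Finset.mem_union, Finset.mem_image]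
    constructor
    · intro h
      refine ⟨?_, fun x hx => h x (Or.inl (Or.inl hx)),
        fun x hx => h _ (Or.inl (Or.inr ⟨x, hx, by ring⟩))⟩
      by_cases h0 : k = 0
      · exact Or.inl h0
      · refine Or.inr (h k (Or.inr ?_))
        rw [if_pos (by omega)]; simp
    · rintro ⟨h1, h2, h3⟩ x ((hx | ⟨e, he, rfl⟩) | hx)
      · exact h2 x hx
      · exact h3 e he
      · split_ifs at hx with h
        · rw [Finset.mem_singleton] at hx
          subst hx
          rcases h1 with h1 | h1
          · omega
          · exact h1
        · simp at hx
  split_ifs with hc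
  · rw [AA, AA, mul_assoc, Finset.sum_mul_sum, Finset.mul_sum]
    refine Finset.sum_congr rfl fun a ha => ?_
    rw [Finset.mul_sum]
    refine Finset.sum_congr rfl fun b hb => ?_
    have hk1 := key a ha b
    rw [mem_trees] at ha hb
    have hal : (PTree.node a b).alpha = n.choose k * (a.alpha * b.alpha) := by
      simp only [PTree.alpha, ha, hb]
      rw [show k + (n - k) = n by omega, mul_assoc]
    by_cases h1 : ∀ x ∈ (desc a).dset, P x
    · by_cases h2 : ∀ x ∈ (desc b).dset, P (x + (k + 1))
      · rw [if_pos (hk1.2 ⟨hc, h1, h2⟩), if_pos h1, if_pos h2, hal]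
      · rw [if_neg (fun h => h2 (hk1.1 h).2.2), if_neg h2]; simp
    · rw [if_neg (fun h => h1 (hk1.1 h).2.1), if_neg h1]; simp
  · refine Finset.sum_eq_zero fun a ha => Finset.sum_eq_zero fun b _ => ?_
    rw [if_neg (fun h => hc ((key a ha b).1 h).1)]

theorem AA_one (n : ℕ) (P : ℕ → Prop) (h : ∀ x, 1 ≤ x → x ≤ n - 1 → ¬ P x) : AA n P = 1 := by
  induction n generalizing P with
  | zero => exact AA_zero P
  | succ n ih =>
    rw [AA_succ, Finset.sum_eq_single 0]
    · simp only [true_or, if_true, AA_zero, Nat.choose_zero_right, Nat.sub_zero, one_mul]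
      exact ih _ fun x h1 h2 => h _ (by omega) (by omega)
    · intro k hk h0
      rw [Finset.mem_range] at hk
      rw [if_neg]
      rintro (h1 | h1)
      · exact h0 h1
      · exact h k (by omega) (by omega) h1
    · simp

theorem AA_split (n : ℕ) : ∀ (P : ℕ → Prop) (d : ℕ), P d → d ≤ n →
    AA n P = n.choose d * AA d P * AA (n - d) (fun x => P (x + d)) := by
  classical
  induction n using Nat.strong_induction_on with
  | _ n ih =>
    intro P d hd hdn
    rcases Nat.eq_zero_or_pos d with rfl | hpos
    · simp [AA_zero]
    obtain ⟨e, rfl⟩ : ∃ e, d = e + 1 := ⟨d - 1, by omega⟩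
    obtain ⟨n, rfl⟩ : ∃ m, n = m + 1 := ⟨n - 1, by omega⟩
    have hsplit : n + 1 = (e + 1) + (n - e) := by omega
    rw [AA_succ, hsplit, Finset.sum_range_add, ← hsplit]
    have hA : (∑ k ∈ Finset.range (e + 1), if k = 0 ∨ P k then
        n.choose k * AA k P * AA (n - k) (fun x => P (x + (k + 1))) else 0)
        = n.choose e * AA (e + 1) P * AA (n - e) (fun x => P (x + (e + 1))) := by
      rw [AA_succ e, Finset.mul_sum, Finset.sum_mul]
      refine Finset.sum_congr rfl fun k hk => ?_
      rw [Finset.mem_range] at hk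
      split_ifs with hc
      · rw [ih (n - k) (by omega) _ (e - k)
          (by simpa [show e - k + (k + 1) = e + 1 by omega] using hd) (by omega)]
        have h1 : n.choose k * (n - k).choose (e - k) = n.choose e * e.choose k :=
          (Nat.choose_mul (by omega : k ≤ e)).symm
        have h2 : (fun x => P (x + (e - k) + (k + 1))) = fun x => P (x + (e + 1)) := by
          funext x
          rw [show x + (e - k) + (k + 1) = x + (e + 1) by omega]
        rw [h2, show n - k - (e - k) = n - e by omega]
        linear_combination AA k P * AA (e - k) (fun x => P (x + (k + 1))) *
          AA (n - e) (fun x => P (x + (e + 1))) * h1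
      · simp
    have hB : (∑ i ∈ Finset.range (n - e), if e + 1 + i = 0 ∨ P (e + 1 + i) then
        n.choose (e + 1 + i) * AA (e + 1 + i) P *
          AA (n - (e + 1 + i)) (fun x => P (x + (e + 1 + i + 1))) else 0)
        = n.choose (e + 1) * AA (e + 1) P * AA (n - e) (fun x => P (x + (e + 1))) := by
      rcases Nat.eq_zero_or_pos (n - e) with h0 | h0
      · rw [h0, Nat.choose_eq_zero_of_lt (by omega)]; simp
      obtain ⟨m, hm⟩ : ∃ m, n - e = m + 1 := ⟨n - e - 1, by omega⟩
      rw [hm, AA_succ m, Finset.mul_sum]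
      refine Finset.sum_congr rfl fun i hi => ?_
      rw [Finset.mem_range] at hi
      have hiff : (e + 1 + i = 0 ∨ P (e + 1 + i)) ↔ (i = 0 ∨ P (i + (e + 1))) := by
        rw [add_comm i]
        constructor
        · rintro (h | h)
          · omega
          · exact Or.inr h
        · rintro (h | h)
          · subst h; exact Or.inr hd
          · exact Or.inr h
      by_cases hc : i = 0 ∨ P (i + (e + 1))
      · rw [if_pos (hiff.2 hc), if_pos hc, ih (e + 1 + i) (by omega) P (e + 1) hd (by omega)]
        have h1 : n.choose (e + 1 + i) * (e + 1 + i).choose (e + 1) =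
            n.choose (e + 1) * m.choose i := by
          rw [Nat.choose_mul (by omega)]
          congr 2 <;> omega
        have h2 : (fun x => P (x + (e + 1 + i + 1))) = fun x => P (x + (i + 1) + (e + 1)) := by
          funext x
          rw [show x + (e + 1 + i + 1) = x + (i + 1) + (e + 1) by omega]
        rw [h2, show n - (e + 1 + i) = m - i by omega, show e + 1 + i - (e + 1) = i by omega]
        linear_combination AA (e + 1) P * AA i (fun x => P (x + (e + 1))) *
          AA (m - i) (fun x => P (x + (i + 1) + (e + 1))) * h1
      · rw [if_neg (fun h => hc (hiff.1 h)), if_neg hc]; simp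
    rw [hA, hB, Nat.choose_succ_succ, show n + 1 - (e + 1) = n - e by omega]
    ring

theorem AA_chain (n : ℕ) (L : List ℕ) : ∀ prev, L.Pairwise (· < ·) →
    (∀ x ∈ L, prev < x ∧ x ≤ n) →
    AA (n - prev) (fun x => x + prev ∈ L) = chainProdAux n prev L := by
  induction L with
  | nil => intro prev _ _; exact AA_one _ _ (by simp)
  | cons b t ih =>
    intro prev hs hb
    rw [List.pairwise_cons] at hs
    have hb0 := hb b (by simp)
    rw [chainProdAux, AA_split (n - prev) _ (b - prev) (by simp [show b - prev + prev = b by omega])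
      (by omega), ← ih b hs.2 (fun x hx => ⟨hs.1 x hx, (hb x (by simp [hx])).2⟩),
      AA_one (b - prev), mul_one, show n - prev - (b - prev) = n - b by omega]
    · congr 1
      apply AA_congr
      intro x h1 _
      rw [show x + (b - prev) + prev = x + b by omega, List.mem_cons]
      constructor
      · rintro (h | h)
        · omega
        · exact h
      · exact Or.inr
    · intro x h1 h2 h
      rw [List.mem_cons] at h
      rcases h with h | h
      · omega
      · have := hs.1 _ h; omega

theorem alt_sum {ℓ : ℕ} (d : Fin ℓ → ℕ) (hinj : Function.Injective d) (E : Finset ℕ) :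
    (∑ S : Finset (Fin ℓ), if ∀ x ∈ E, x ∈ S.image d then (-1 : ℤ) ^ (S.card + ℓ) else 0) =
      if E = Finset.univ.image d then 1 else 0 := by
  classical
  by_cases hE : E ⊆ Finset.univ.image d
  · obtain ⟨U, rfl⟩ : ∃ U : Finset (Fin ℓ), E = U.image d := by
      obtain ⟨U, _, hU⟩ := Finset.subset_image_iff.1 hE
      exact ⟨U, hU.symm⟩
    have h1 : ∀ S : Finset (Fin ℓ), (∀ x ∈ U.image d, x ∈ S.image d) ↔ Sᶜ ⊆ Uᶜ := by
      intro S
      rw [Finset.compl_subset_compl, ← Finset.image_subset_image_iff hinj]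
      rfl
    have h2 : (U.image d = Finset.univ.image d) ↔ Uᶜ = ∅ := by
      rw [(Finset.image_injective hinj).eq_iff, Finset.compl_eq_empty_iff]
    simp only [h1, h2]
    rw [← Finset.sum_powerset_neg_one_pow_card, ← Finset.sum_filter]
    refine Finset.sum_bij' (fun S _ => Sᶜ) (fun S _ => Sᶜ) ?_ ?_ ?_ ?_ ?_
    · intro S hS
      rw [Finset.mem_filter] at hS
      exact Finset.mem_powerset.2 hS.2
    · intro S hS
      rw [Finset.mem_filter, compl_compl]
      exact ⟨Finset.mem_univ _, Finset.mem_powerset.1 hS⟩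
    · simp
    · simp
    · intro S _
      have := Finset.card_add_card_compl S
      rw [Fintype.card_fin] at this
      rw [show S.card + ℓ = (S.card + S.card) + Sᶜ.card by omega, pow_add, Even.neg_one_pow ⟨_, rfl⟩, one_mul]
  · rw [if_neg (fun h : E = _ => hE h.subset)]
    refine Finset.sum_eq_zero fun S _ => if_neg fun h => hE fun x hx => ?_
    exact Finset.image_subset_image (Finset.subset_univ S) (h x hx)

theorem omegaD_eq (D : Descent) :
    omegaD D = ∑ t ∈ treesOfGrade D.grade, if (desc t).dset = D.dset then t.alpha else 0 := by
  classical
  have h1 : ∀ t, (∑ᶠ (_ : desc t = D), PTree.alpha t) = if desc t = D then t.alpha else 0 := by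
    intro t
    rw [finsum_eq_if]
  rw [omegaD, finsum_congr h1, finsum_eq_sum_of_support_subset (s := treesOfGrade D.grade)]
  · refine Finset.sum_congr rfl fun t ht => ?_
    rw [mem_trees, ← desc_grade] at ht
    congr 1
    apply propext
    constructor
    · rintro rfl; rfl
    · intro h
      cases hh : desc t
      cases D
      simp_all
  · intro t ht
    rw [Function.mem_support] at ht
    have : desc t = D := by
      by_contra h
      exact ht (if_neg h)
    rw [Finset.mem_coe, mem_trees, ← this, desc_grade]

theorem omega_formula {ℓ : ℕ} (n : ℕ) (d : Fin ℓ → ℕ) (hmono : StrictMono d)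
    (hd : ∀ i, 1 ≤ d i ∧ d i ≤ n) (hv : Finset.univ.image d ⊆ Finset.Icc 1 (n - 1)) :
    (omegaD ⟨n, Finset.univ.image d, hv⟩ : ℤ) =
      ∑ S : Finset (Fin ℓ), (-1 : ℤ) ^ (S.card + ℓ) *
        chainProdAux n 0 ((S.sort (· ≤ ·)).map d) := by
  classical
  have h1 : ∀ S : Finset (Fin ℓ), chainProdAux n 0 ((S.sort (· ≤ ·)).map d) =
      AA n (fun x => x ∈ S.image d) := by
    intro S
    rw [← AA_chain]
    · apply AA_congr
      intro x _ _
      simp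
    · rw [List.pairwise_map]
      exact (Finset.sortedLT_sort S).pairwise.imp fun h => hmono h
    · intro x hx
      simp only [List.mem_map] at hx
      obtain ⟨i, _, rfl⟩ := hx
      have := hd i
      omega
  simp only [h1]
  rw [omegaD_eq]
  simp only [AA]
  push_cast
  simp only [Finset.mul_sum]
  rw [Finset.sum_comm]
  refine Finset.sum_congr rfl fun t _ => ?_
  have h2 := alt_sum d hmono.injective (desc t).dset
  calc _ = (if (desc t).dset = Finset.univ.image d then (1 : ℤ) else 0) * t.alpha := by
        split_ifs <;> simp
    _ = _ := by
      rw [← h2, Finset.sum_mul]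
      refine Finset.sum_congr rfl fun S _ => ?_
      split_ifs <;> simp

theorem chainAux_shift (n : ℕ) (t : List ℕ) : ∀ a, 1 ≤ a → (∀ x ∈ t, 1 ≤ x) →
    chainProdAux (n - 1) (a - 1) (t.map (fun x => x - 1)) = chainProdAux n a t := by
  induction t with
  | nil => intro a _ _; rfl
  | cons b t ih =>
    intro a ha h
    have hb := h b (by simp)
    rw [List.map_cons, chainProdAux, chainProdAux, ih b hb (fun x hx => h x (by simp [hx])),
      show n - 1 - (a - 1) = n - a by omega, show b - 1 - (a - 1) = b - a by omega]

theorem chain_diff (n : ℕ) (hn : 1 ≤ n) (L : List ℕ) (hL : L ≠ []) (h : ∀ x ∈ L, 1 ≤ x) :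
    chainProdAux n 0 L = chainProdAux (n - 1) 0 (L.map (fun x => x - 1)) + chainProd' n L := by
  cases L with
  | nil => exact absurd rfl hL
  | cons a t =>
    have ha := h a (by simp)
    rw [List.map_cons, chainProdAux, chainProdAux, chainProd',
      chainAux_shift n t a ha (fun x hx => h x (by simp [hx]))]
    obtain ⟨a, rfl⟩ : ∃ e, a = e + 1 := ⟨a - 1, by omega⟩
    obtain ⟨n, rfl⟩ : ∃ e, n = e + 1 := ⟨n - 1, by omega⟩
    simp only [Nat.sub_zero, Nat.add_sub_cancel, Nat.choose_succ_succ]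
    ring

/-- The intermediate ordered-subset recursion for the descent weight: for
`2 ≤ d₁ < ⋯ < d_ℓ ≤ n−1`,
`ω((n, {d₁,…,d_ℓ})) = ω((n−1, {d₁−1,…,d_ℓ−1})) + Σ_{∅ ≠ S ⊆ {1,…,ℓ}} (−1)^{|S|+ℓ}
C(n−1, d_{p₁}) ∏_{i=2}^{|S|} C(n − d_{p_{i−1}}, d_{p_i} − d_{p_{i−1}})`. -/
theorem weight_recursion (n ℓ : ℕ) (hn : 2 ≤ n) (hℓ : 1 ≤ ℓ) (d : Fin ℓ → ℕ)
    (hmono : StrictMono d) (hd : ∀ i, 2 ≤ d i ∧ d i ≤ n - 1) :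
    (omegaD ⟨n, Finset.image d Finset.univ, by
        intro x hx
        simp only [Finset.mem_image] at hx
        obtain ⟨i, -, rfl⟩ := hx
        have h := hd i
        rw [Finset.mem_Icc]
        omega⟩ : ℤ) =
      (omegaD ⟨n - 1, Finset.image (fun i => d i - 1) Finset.univ, by
          intro x hx
          simp only [Finset.mem_image] at hx
          obtain ⟨i, -, rfl⟩ := hx
          have h := hd i
          rw [Finset.mem_Icc]
          omega⟩ : ℤ) +
        ∑ S ∈ Finset.univ.filter fun S : Finset (Fin ℓ) => S.Nonempty,
          (-1 : ℤ) ^ (S.card + ℓ) * chainProd' n ((S.sort (· ≤ ·)).map d) := by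
  classical
  rw [omega_formula n d hmono (fun i => by have := hd i; omega),
    omega_formula (n - 1) (fun i => d i - 1)
      (fun i j hij => by
        have := hmono hij
        have := hd i
        show d i - 1 < d j - 1
        omega) (fun i => by have := hd i; show 1 ≤ d i - 1 ∧ d i - 1 ≤ n - 1; omega),
    Finset.sum_filter, ← Finset.sum_add_distrib]
  refine Finset.sum_congr rfl fun S _ => ?_
  split_ifs with hS
  · rw [chain_diff n (by omega) ((S.sort (· ≤ ·)).map d)]
    · rw [List.map_map]
      push_cast
      rw [mul_add]
      rfl
    · intro h
      have h2 := congrArg List.length h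
      simp only [List.length_map, Finset.length_sort, List.length_nil] at h2
      have := Finset.card_pos.2 hS
      omega
    · intro x hx
      simp only [List.mem_map] at hx
      obtain ⟨i, _, rfl⟩ := hx
      have := hd i
      omega
  · rw [Finset.not_nonempty_iff_eq_empty] at hS
    subst hS
    simp [chainProdAux]
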